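/- Let w be a word over {a,b} and y a letter. If wy is trapezoidal but not Sturmian, then w is open. -/

import Mathlib

/-- The two-letter alphabet {a, b}. -/
inductive AB : Type
  | a : AB
  | b : AB
deriving DecidableEq, Repr

/-- A (finite) word over {a, b}. -/
abbrev Word := List AB

open AB

/-- `u` occurs in `w` at position `i`. -/
def OccursAt (u w : Word) (i : ℕ) : Prop :=
  i + u.length ≤ w.length ∧ (w.drop i).take u.length = u

/-- `u` occurs exactly once in `w` (is unrepeated in `w`). -/
def OccursOnce (u w : Word) : Prop := ∃! i, OccursAt u w i

/-- `u` is a right special factor of `w`: both `ua` and `ub` are factors of `w`. -/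
def IsRightSpecial (u w : Word) : Prop := (u ++ [a]) <:+: w ∧ (u ++ [b]) <:+: w

/-- `u` is a left special factor of `w`: both `au` and `bu` are factors of `w`. -/
def IsLeftSpecial (u w : Word) : Prop := ([a] ++ u) <:+: w ∧ ([b] ++ u) <:+: w

/-- `K w`: the length of the shortest unrepeated suffix of `w`. -/
noncomputable def Kp (w : Word) : ℕ := sInf {n | ∃ s : Word, s <:+ w ∧ s.length = n ∧ OccursOnce s w}

/-- `H w`: the length of the shortest unrepeated prefix of `w`. -/
noncomputable def Hp (w : Word) : ℕ := sInf {n | ∃ p : Word, p <+: w ∧ p.length = n ∧ OccursOnce p w}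

/-- `R w`: the smallest `n ≥ 0` such that `w` has no right special factor of length `n`. -/
noncomputable def Rp (w : Word) : ℕ := sInf {n | ∀ u : Word, u.length = n → ¬ IsRightSpecial u w}

/-- `L w`: the smallest `n ≥ 0` such that `w` has no left special factor of length `n`. -/
noncomputable def Lp (w : Word) : ℕ := sInf {n | ∀ u : Word, u.length = n → ¬ IsLeftSpecial u w}

/-- A word `w` is trapezoidal if `|w| = K w + R w`. -/
def IsTrapezoidal (w : Word) : Prop := w.length = Kp w + Rp w

/-- A finite word over `{a,b}` is Sturmian iff it is balanced: there is no word `u`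
with both `aua` and `bub` factors of `w`. -/
def IsSturmian (w : Word) : Prop :=
  ¬ ∃ u : Word, ([a] ++ u ++ [a]) <:+: w ∧ ([b] ++ u ++ [b]) <:+: w

/-- A nonempty word is closed if it has a border (a proper prefix which is also a suffix)
whose only occurrences in `w` are as a prefix and as a suffix. -/
def IsClosedWord (w : Word) : Prop :=
  w ≠ [] ∧ ∃ v : Word, v <+: w ∧ v.length < w.length ∧ v <:+ w ∧
    ∀ i : ℕ, OccursAt v w i → i = 0 ∨ i + v.length = w.length

/-- A nonempty word is open if it is not closed. -/
def IsOpenWord (w : Word) : Prop := w ≠ [] ∧ ¬ IsClosedWord w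

/-- Central words: `a^n`, `b^n`, or `u a b v = v b a u`. -/
def IsCentral (w : Word) : Prop :=
  (∃ n : ℕ, w = List.replicate n a) ∨ (∃ n : ℕ, w = List.replicate n b) ∨
  (∃ u v : Word, w = u ++ [a, b] ++ v ∧ w = v ++ [b, a] ++ u)

/-- The minimal period of `w`: `|w|` minus the length of the longest border of `w`. -/
noncomputable def minPeriod (w : Word) : ℕ :=
  w.length - sSup {n | ∃ v : Word, v.length = n ∧ v <+: w ∧ v ≠ w ∧ v <:+ w}

/-! ### Factors of a periodic sequence, described by positions -/

/-- The length `n` factors of `Z` at positions `i` and `j` are equal. -/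
def Agree (Z : ℕ → AB) (n i j : ℕ) : Prop := ∀ k < n, Z (i + k) = Z (j + k)

/-- The length `n` factors of `Z` at positions `i` and `j` are equal, but are followed by
different letters. -/
def Branches (Z : ℕ → AB) (n i j : ℕ) : Prop := Agree Z n i j ∧ Z (i + n) ≠ Z (j + n)

/-- The sequence `Z` has factors `cuc` at position `i` and `dud` at position `j`, where `c ≠ d` are
letters and `|u| = m`. -/
def Imbalance (Z : ℕ → AB) (m i j : ℕ) : Prop :=
  Z i ≠ Z j ∧ Z (i + m + 1) = Z i ∧ Z (j + m + 1) = Z j ∧ Agree Z m (i + 1) (j + 1)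

/-- The length `n` factor of `Z` at position `i`. -/
def window (Z : ℕ → AB) (n i : ℕ) : Fin n → AB := fun k => Z (i + k)

/-- The length `n` factors of `Z` at positions less than `p`. -/
def windows (Z : ℕ → AB) (p n : ℕ) : Finset (Fin n → AB) := (Finset.range p).image (window Z n)

theorem AB.eq_of_ne_of_ne {x y z : AB} (h : x ≠ y) (h' : z ≠ y) : x = z := by
  cases x <;> cases y <;> cases z <;> simp_all

theorem Agree.symm {Z : ℕ → AB} {n i j : ℕ} (h : Agree Z n i j) : Agree Z n j i :=
  fun k hk => (h k hk).symm

theorem Agree.trans {Z : ℕ → AB} {n i j l : ℕ} (h : Agree Z n i j) (h' : Agree Z n j l) :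
    Agree Z n i l := fun k hk => (h k hk).trans (h' k hk)

theorem agree_succ_iff_last {Z : ℕ → AB} {n i j : ℕ} :
    Agree Z (n + 1) i j ↔ Agree Z n i j ∧ Z (i + n) = Z (j + n) := by
  refine ⟨fun h => ⟨fun k hk => h k (by omega), h n (by omega)⟩, fun h k hk => ?_⟩
  rcases Nat.lt_succ_iff_lt_or_eq.mp hk with hk | rfl
  exacts [h.1 k hk, h.2]

theorem agree_succ_iff_head {Z : ℕ → AB} {n i j : ℕ} :
    Agree Z (n + 1) i j ↔ Z i = Z j ∧ Agree Z n (i + 1) (j + 1) := by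
  refine ⟨fun h => ⟨h 0 (by omega), fun k hk => ?_⟩, fun h k hk => ?_⟩
  · have := h (k + 1) (by omega)
    rwa [show i + 1 + k = i + (k + 1) by omega, show j + 1 + k = j + (k + 1) by omega]
  · rcases k with _ | k
    · exact h.1
    · have := h.2 k (by omega)
      rwa [show i + 1 + k = i + (k + 1) by omega, show j + 1 + k = j + (k + 1) by omega] at this

theorem window_eq_iff {Z : ℕ → AB} {n i j : ℕ} : window Z n i = window Z n j ↔ Agree Z n i j :=
  ⟨fun h k hk => congrFun h ⟨k, hk⟩, fun h => funext fun k => h k k.2⟩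

theorem Branches.symm {Z : ℕ → AB} {n i j : ℕ} (h : Branches Z n i j) : Branches Z n j i :=
  ⟨h.1.symm, h.2.symm⟩

theorem Branches.tail {Z : ℕ → AB} {n i j : ℕ} (h : Branches Z (n + 1) i j) :
    Branches Z n (i + 1) (j + 1) := by
  refine ⟨(agree_succ_iff_head.mp h.1).2, ?_⟩
  have := h.2
  rwa [show i + 1 + n = i + (n + 1) by omega, show j + 1 + n = j + (n + 1) by omega]

theorem Branches.shorten {Z : ℕ → AB} {n m i j : ℕ} (h : Branches Z n i j) (hm : m ≤ n) :
    ∃ i j, Branches Z m i j := by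
  induction n, hm using Nat.le_induction generalizing i j with
  | base => exact ⟨i, j, h⟩
  | succ n _ ih => exact ih h.tail

theorem Imbalance.symm {Z : ℕ → AB} {m i j : ℕ} (h : Imbalance Z m i j) : Imbalance Z m j i :=
  ⟨h.1.symm, h.2.2.1, h.2.1, h.2.2.2.symm⟩

theorem Imbalance.branches {Z : ℕ → AB} {m i j : ℕ} (h : Imbalance Z m i j) :
    Branches Z m (i + 1) (j + 1) := by
  obtain ⟨h1, h2, h3, h4⟩ := h
  refine ⟨h4, ?_⟩
  rwa [show i + 1 + m = i + m + 1 by omega, show j + 1 + m = j + m + 1 by omega, h2, h3]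

section Periodic

variable {Z : ℕ → AB} {p : ℕ}

theorem window_mem_windows (hp : 0 < p) (hZ : Function.Periodic Z p) (n i : ℕ) :
    window Z n i ∈ windows Z p n := by
  refine Finset.mem_image.mpr ⟨i % p, Finset.mem_range.mpr (Nat.mod_lt _ hp), ?_⟩
  refine window_eq_iff.mpr fun k _ => ?_
  rw [← hZ.map_mod_nat (i % p + k), ← hZ.map_mod_nat (i + k), Nat.mod_add_mod]

theorem card_windows_le (n : ℕ) : (windows Z p n).card ≤ p :=
  Finset.card_image_le.trans (Finset.card_range p).le

theorem card_windows_add_card_le (hp : 0 < p) (hZ : Function.Periodic Z p) {n : ℕ}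
    {T : Finset (Fin (n + 1) → AB)} (hT : T ⊆ windows Z p (n + 1))
    (h : ∀ i, ∃ j, Agree Z n i j ∧ window Z (n + 1) j ∉ T) :
    (windows Z p n).card + T.card ≤ (windows Z p (n + 1)).card := by
  have hsub : windows Z p n ⊆
      (windows Z p (n + 1) \ T).image (fun g (k : Fin n) => g k.castSucc) := by
    intro g hg
    obtain ⟨i, -, rfl⟩ := Finset.mem_image.mp hg
    obtain ⟨j, hj, hjT⟩ := h i
    refine Finset.mem_image.mpr ⟨window Z (n + 1) j,
      Finset.mem_sdiff.mpr ⟨window_mem_windows hp hZ _ _, hjT⟩, ?_⟩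
    exact funext fun k => (hj k k.2).symm
  have h1 := (Finset.card_le_card hsub).trans Finset.card_image_le
  have h2 := Finset.card_sdiff_add_card_eq_card hT
  omega

theorem card_windows_lt_of_branches (hp : 0 < p) (hZ : Function.Periodic Z p) {n i j : ℕ}
    (h : Branches Z n i j) : (windows Z p n).card < (windows Z p (n + 1)).card := by
  have := card_windows_add_card_le hp hZ (T := {window Z (n + 1) j})
    (by simpa using window_mem_windows hp hZ _ _) fun l => by
      by_cases hl : Agree Z (n + 1) l j
      · refine ⟨i, (agree_succ_iff_last.mp hl).1.trans h.1.symm, ?_⟩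
        rw [Finset.mem_singleton, window_eq_iff]
        exact fun h' => h.2 (agree_succ_iff_last.mp h').2
      · exact ⟨l, fun _ _ => rfl, by rwa [Finset.mem_singleton, window_eq_iff]⟩
  simpa using this

theorem card_windows_add_two_le (hp : 0 < p) (hZ : Function.Periodic Z p) {n i i' j j' : ℕ}
    (h : Branches Z n i i') (h' : Branches Z n j j') (hij : ¬ Agree Z n i j) :
    (windows Z p n).card + 2 ≤ (windows Z p (n + 1)).card := by
  have hne : window Z (n + 1) i' ≠ window Z (n + 1) j' := fun e =>
    hij ((h.1.trans (agree_succ_iff_last.mp (window_eq_iff.mp e)).1).trans h'.1.symm)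
  rw [← Finset.card_pair hne]
  refine card_windows_add_card_le hp hZ ?_ fun l => ?_
  · simp [Finset.insert_subset_iff, window_mem_windows hp hZ]
  · simp only [Finset.mem_insert, Finset.mem_singleton, window_eq_iff, agree_succ_iff_last]
    by_cases hi : Agree Z n l i
    · refine ⟨i, hi, ?_⟩
      rintro (h1 | h1)
      · exact h.2 h1.2
      · exact hij (h1.1.trans h'.1.symm)
    by_cases hj : Agree Z n l j
    · refine ⟨j, hj, ?_⟩
      rintro (h1 | h1)
      · exact hij (h.1.trans h1.1.symm)
      · exact h'.2 h1.2
    refine ⟨l, fun _ _ => rfl, ?_⟩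
    rintro (h1 | h1)
    · exact hi (h1.1.trans h.1.symm)
    · exact hj (h1.1.trans h'.1.symm)

theorem card_windows_add_le (hp : 0 < p) (hZ : Function.Periodic Z p) {n d : ℕ}
    (h : ∀ m < n + d, ∃ i j, Branches Z m i j) :
    (windows Z p n).card + d ≤ (windows Z p (n + d)).card := by
  induction d with
  | zero => rfl
  | succ d ih =>
    obtain ⟨i, j, hij⟩ := h (n + d) (by omega)
    have := card_windows_lt_of_branches hp hZ hij
    have := ih fun m hm => h m (by omega)
    change _ ≤ (windows Z p (n + d + 1)).card
    omega

theorem succ_le_card_windows (hp : 0 < p) (hZ : Function.Periodic Z p) {n : ℕ}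
    (h : ∀ m < n, ∃ i j, Branches Z m i j) : n + 1 ≤ (windows Z p n).card := by
  have h0 : 0 < (windows Z p 0).card := Finset.card_pos.mpr ⟨_, window_mem_windows hp hZ 0 0⟩
  have h1 := card_windows_add_le hp hZ (n := 0) (d := n) (by simpa using h)
  rw [zero_add] at h1
  omega

theorem Branches.add_two_le (hp : 0 < p) (hZ : Function.Periodic Z p) {n i j : ℕ}
    (h : Branches Z n i j) : n + 2 ≤ p := by
  have h1 := succ_le_card_windows hp hZ (n := n + 1) fun m hm => h.shorten (by omega)
  have h2 := card_windows_le (Z := Z) (p := p) (n + 1)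
  omega

theorem card_windows_le_succ (hp : 0 < p) (hZ : Function.Periodic Z p) {i j : ℕ}
    (h : Branches Z (p - 2) i j) {n : ℕ} (hn : n < p) : (windows Z p n).card ≤ n + 1 := by
  have h1 := card_windows_add_le hp hZ (n := n) (d := p - 1 - n) fun m hm => h.shorten (by omega)
  have h2 := card_windows_le (Z := Z) (p := p) (n + (p - 1 - n))
  omega

theorem Imbalance.exists_shorter (hp : 0 < p) (hZ : Function.Periodic Z p) {m i j : ℕ}
    (h : Imbalance Z m i j) (hbr : ∀ l l', Branches Z (m + 1) l l' → Agree Z (m + 1) l j)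
    (hcard : (windows Z p (m + 1)).card ≤ m + 2) :
    ∃ m' < m, ∃ i j, Imbalance Z m' i j := by
  obtain ⟨hne, hi, hj, hagree⟩ := h
  have hex : ∃ t, Agree Z (m + 1) (i + t) j := by
    refine ⟨j + i * p - i, fun k _ => ?_⟩
    have : i ≤ i * p := Nat.le_mul_of_pos_right i hp
    rw [show i + (j + i * p - i) + k = j + k + i * p by omega]
    exact hZ.nat_mul i (j + k)
  classical
  obtain ⟨t, ht, hmin⟩ : ∃ t, Agree Z (m + 1) (i + t) j ∧
      ∀ s < t, ¬ Agree Z (m + 1) (i + s) j :=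
    ⟨Nat.find hex, Nat.find_spec hex, fun s hs => Nat.find_min hex hs⟩
  have ht0 : t ≠ 0 := by
    rintro rfl
    exact hne (ht 0 (by omega))
  have hinj : ∀ s s', s < s' → s' ≤ t → ¬ Agree Z (m + 1) (i + s) (i + s') := by
    intro s s' hss hst hag
    have hshift : ∀ r, s' + r ≤ t → Agree Z (m + 1) (i + s + r) (i + s' + r) := by
      intro r
      induction r with
      | zero => exact fun _ => hag
      | succ r ih =>
        intro hr
        have h1 := ih (by omega)
        have h2 : Z (i + s + r + (m + 1)) = Z (i + s' + r + (m + 1)) := by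
          by_contra hcon
          have h3 := hbr _ _ ⟨h1, hcon⟩
          rw [add_assoc] at h3
          exact hmin (s + r) (by omega) h3
        exact (agree_succ_iff_head.mp (agree_succ_iff_last.mpr ⟨h1, h2⟩)).2
    have h1 := hshift (t - s') (by omega)
    rw [show i + s' + (t - s') = i + t by omega,
      show i + s + (t - s') = i + (s + (t - s')) by omega] at h1
    exact hmin _ (by omega) (h1.trans ht)
  have hle : t + 1 ≤ (windows Z p (m + 1)).card := by
    rw [← Finset.card_range (t + 1)]
    refine Finset.card_le_card_of_injOn (fun s => window Z (m + 1) (i + s))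
      (fun s _ => window_mem_windows hp hZ _ _) ?_
    intro s hs s' hs' hss
    have hs := Finset.mem_range.mp hs
    have hs' := Finset.mem_range.mp hs'
    have hag := window_eq_iff.mp hss
    rcases lt_trichotomy s s' with hlt | heq | hlt
    · exact (hinj s s' hlt (by omega) hag).elim
    · exact heq
    · exact (hinj s' s hlt (by omega) hag.symm).elim
  have hZt : Z (i + t) = Z j := ht 0 (by omega)
  have htm : t ≠ m + 1 := by
    rintro rfl
    exact hne (hi.symm.trans hZt)
  obtain ⟨d, rfl⟩ : ∃ d, m = d + t := ⟨m - t, by omega⟩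
  have hZjt : Z (j + t) = Z j := by
    have := hagree (t - 1) (by omega)
    rw [show i + 1 + (t - 1) = i + t by omega, show j + 1 + (t - 1) = j + t by omega] at this
    exact this.symm.trans hZt
  refine ⟨d, by omega, i, j + t, by rwa [hZjt], ?_, ?_, fun k hk => ?_⟩
  · have h1 := ht (d + 1) (by omega)
    have h2 := hagree d (by omega)
    rw [show i + t + (d + 1) = i + (d + t) + 1 by omega, hi] at h1
    rw [show i + 1 + d = i + d + 1 by omega, show j + 1 + d = j + (d + 1) by omega] at h2
    exact h2.trans h1.symm
  · rw [show j + t + d + 1 = j + (d + t) + 1 by omega, hj, hZjt]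
  · have h1 := hagree (t + k) (by omega)
    have h2 := ht (k + 1) (by omega)
    have h3 := hagree k (by omega)
    rw [show i + 1 + (t + k) = i + t + (k + 1) by omega,
      show j + 1 + (t + k) = j + t + 1 + k by omega] at h1
    rw [show j + 1 + k = j + (k + 1) by omega] at h3
    exact h3.trans (h2.symm.trans h1)

/-- A sequence of period `p` with a right special factor of length `p - 2` is balanced. -/
theorem not_imbalance_of_periodic (hp : 0 < p) (hZ : Function.Periodic Z p)
    (hRS : 2 ≤ p → ∃ i j, Branches Z (p - 2) i j) (m i j : ℕ) : ¬ Imbalance Z m i j := by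
  induction m using Nat.strong_induction_on generalizing i j with
  | _ m ih =>
  intro h
  have hm := h.branches.add_two_le hp hZ
  obtain ⟨i₀, j₀, h₀⟩ := hRS (by omega)
  have hcard := card_windows_le_succ hp hZ h₀ (n := m + 1) (by omega)
  have hlow : ∀ n ≤ m + 1, n + 1 ≤ (windows Z p n).card := fun n hn =>
    succ_le_card_windows hp hZ fun k hk => h.branches.shorten (by omega)
  have hext : ∀ l l', Branches Z (m + 1) l l' →
      Agree Z (m + 1) l i ∨ Agree Z (m + 1) l j := by
    intro l l' hl
    have hli : Agree Z m (l + 1) (i + 1) := by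
      by_contra hcon
      have h1 := card_windows_add_two_le hp hZ hl.tail h.branches hcon
      have h2 := hlow m (by omega)
      omega
    by_cases hl0 : Z l = Z j
    · exact .inr (agree_succ_iff_head.mpr ⟨hl0, hli.trans h.2.2.2⟩)
    · exact .inl (agree_succ_iff_head.mpr ⟨AB.eq_of_ne_of_ne hl0 h.1, hli⟩)
  have key : ∀ i j, Imbalance Z m i j →
      (∀ l l', Branches Z (m + 1) l l' → Agree Z (m + 1) l j) → False := by
    intro i j h hbr
    obtain ⟨m', hm', i', j', h'⟩ := h.exists_shorter hp hZ hbr hcard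
    exact ih m' hm' i' j' h'
  by_cases hi : ∃ l l', Branches Z (m + 1) l l' ∧ Agree Z (m + 1) l i
  · refine key j i h.symm fun l l' hl => (hext l l' hl).resolve_right fun hlj => ?_
    obtain ⟨r, r', hr, hri⟩ := hi
    have h1 := card_windows_add_two_le hp hZ hl hr fun hlr =>
      h.1 ((hri.symm.trans (hlr.symm.trans hlj)) 0 (by omega))
    have h2 := hlow (m + 1) le_rfl
    have h3 := card_windows_le_succ hp hZ h₀ (n := m + 1 + 1)
      (by have := hl.add_two_le hp hZ; omega)
    omega
  · refine key i j h fun l l' hl => (hext l l' hl).resolve_left fun hli => hi ⟨l, l', hl, hli⟩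

/-- In a sequence of period `p`, a factor of length at least `p - 1` determines the preceding
letter. -/
theorem eq_of_agree_succ (hp : 0 < p) (hZ : Function.Periodic Z p) {n i j : ℕ} (hn : p ≤ n + 1)
    (h : Agree Z n (i + 1) (j + 1)) : Z i = Z j := by
  have hall : ∀ r, Agree Z (n + r) (i + 1) (j + 1) := by
    intro r
    induction r with
    | zero => exact h
    | succ r ih =>
      refine agree_succ_iff_last.mpr ⟨ih, ?_⟩
      by_contra hcon
      have := Branches.add_two_le hp hZ ⟨ih, hcon⟩
      omega
  have h1 := hall p (p - 1) (by omega)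
  rw [show i + 1 + (p - 1) = i + p by omega, show j + 1 + (p - 1) = j + p by omega, hZ, hZ] at h1
  exact h1

/-- Let `X` agree with the sequence `Z` of period `p` on `[0, p + ℓ)`, where the factor of length
`ℓ` at position `0` has exactly the occurrences `0` and `p` there. If the prefix of `X` of
length `p + ℓ + 1` is trapezoidal, then it is balanced. -/
theorem not_imbalance_of_trapezoidal {X : ℕ → AB} {ℓ K R : ℕ} (hp : 0 < p)
    (hZ : Function.Periodic Z p) (hX : ∀ i < p + ℓ, X i = Z i)
    (hv : ∀ i ≤ p, Agree X ℓ i p → i = 0 ∨ i = p)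
    (hKR : p + ℓ + 1 = K + R)
    (hK : ∀ n ≤ p + ℓ + 1,
      (∀ i, i + n ≤ p + ℓ + 1 → Agree X n i (p + ℓ + 1 - n) → i + n = p + ℓ + 1) → K ≤ n)
    (hrep : ∀ n < K, ∃ i, i + n < p + ℓ + 1 ∧ Agree X n i (p + ℓ + 1 - n))
    (hR : ∀ n < R, ∃ i j, i + n ≤ p + ℓ ∧ j + n ≤ p + ℓ ∧ Branches X n i j)
    {m i j : ℕ} (hi : i + m + 1 ≤ p + ℓ) (hj : j + m + 1 ≤ p + ℓ) : ¬ Imbalance X m i j := by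
  intro him
  have toBr : ∀ n i j, i + n < p + ℓ → j + n < p + ℓ → Branches X n i j → Branches Z n i j := by
    intro n i j hi hj h
    refine ⟨fun k hk => ?_, ?_⟩
    · rw [← hX _ (by omega), ← hX _ (by omega)]
      exact h.1 k hk
    · rw [← hX _ hi, ← hX _ hj]
      exact h.2
  have toIm : ∀ i j, i + m + 1 < p + ℓ → j + m + 1 < p + ℓ → Imbalance X m i j →
      Imbalance Z m i j := by
    rintro i j hi hj ⟨h1, h2, h3, h4⟩
    refine ⟨?_, ?_, ?_, fun k hk => ?_⟩
    · rwa [← hX i (by omega), ← hX j (by omega)]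
    · rwa [← hX _ hi, ← hX i (by omega)]
    · rwa [← hX _ hj, ← hX j (by omega)]
    · rw [← hX _ (by omega), ← hX _ (by omega)]
      exact h4 k hk
  by_cases hy : X (p + ℓ) = Z (p + ℓ)
  · have hX' : ∀ i ≤ p + ℓ, X i = Z i := fun i hi => by
      rcases hi.lt_or_eq with h | rfl
      exacts [hX i h, hy]
    have hK2 : K ≤ ℓ + 2 := by
      refine hK _ (by omega) fun i hi hag => ?_
      have h1 : Agree X ℓ (i + 1) p := fun k hk => by
        have := hag (k + 1) (by omega)
        rwa [show i + (k + 1) = i + 1 + k by omega,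
          show p + ℓ + 1 - (ℓ + 2) + (k + 1) = p + k by omega] at this
      rcases hv _ (by omega) h1 with h | h <;> omega
    refine not_imbalance_of_periodic hp hZ (fun h2 => ?_) m i j ?_
    · obtain ⟨i, j, hi, hj, h⟩ := hR (p - 2) (by omega)
      refine ⟨i, j, fun k hk => ?_, ?_⟩
      · rw [← hX' _ (by omega), ← hX' _ (by omega)]
        exact h.1 k hk
      · rw [← hX' _ hi, ← hX' _ hj]
        exact h.2
    · obtain ⟨h1, h2, h3, h4⟩ := him
      refine ⟨?_, ?_, ?_, fun k hk => ?_⟩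
      · rwa [← hX' i (by omega), ← hX' j (by omega)]
      · rwa [← hX' _ hi, ← hX' i (by omega)]
      · rwa [← hX' _ hj, ← hX' j (by omega)]
      · rw [← hX' _ (by omega), ← hX' _ (by omega)]
        exact h4 k hk
  · have hZℓ : Z (p + ℓ) = Z ℓ := by rw [add_comm, hZ]
    have hK1 : K ≤ ℓ + 1 := by
      refine hK _ (by omega) fun i hi hag => ?_
      rw [show p + ℓ + 1 - (ℓ + 1) = p by omega] at hag
      obtain ⟨h1, h2⟩ := agree_succ_iff_last.mp hag
      rcases hv _ (by omega) h1 with rfl | h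
      · rw [zero_add, hX ℓ (by omega), ← hZℓ] at h2
        exact (hy h2.symm).elim
      · omega
    have hpK : p ≤ K := by
      by_contra hlt
      have key : ∀ i j, i + (R - 1) = p + ℓ → j + (R - 1) < p + ℓ →
          ¬ Agree X (R - 1) i j := by
        intro i j hi hj hag
        have h1 : Agree X ℓ (j + (R - 1 - ℓ)) p := fun k hk => by
          have := hag (R - 1 - ℓ + k) (by omega)
          rw [show i + (R - 1 - ℓ + k) = p + k by omega, ← add_assoc] at this
          exact this.symm
        rcases hv _ (by omega) h1 with h | h <;> omega
      obtain ⟨i, j, hi, hj, h⟩ := hR (R - 1) (by omega)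
      rcases hi.lt_or_eq with hi' | hi' <;> rcases hj.lt_or_eq with hj' | hj'
      · have := (toBr _ _ _ hi' hj' h).add_two_le hp hZ
        omega
      · exact key j i hj' hi' h.1.symm
      · exact key i j hi' hj' h.1
      · exact h.2 (by rw [hi', hj'])
    have hbal := not_imbalance_of_periodic hp hZ fun h2 => by
      have key : ∀ i j, i + (p - 2) = p + ℓ → j + (p - 2) < p + ℓ →
          Branches X (p - 2) i j → ∃ i j, Branches Z (p - 2) i j := by
        intro i j hi hj h
        obtain ⟨l, hl, hag⟩ := hrep (p - 2 + 1) (by omega)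
        rw [show p + ℓ + 1 - (p - 2 + 1) = i by omega] at hag
        obtain ⟨h1, h2⟩ := agree_succ_iff_last.mp hag
        exact ⟨l, j, toBr _ _ _ (by omega) hj ⟨h1.trans h.1, by rw [h2]; exact h.2⟩⟩
      obtain ⟨i, j, hi, hj, h⟩ := hR (p - 2) (by omega)
      rcases hi.lt_or_eq with hi' | hi' <;> rcases hj.lt_or_eq with hj' | hj'
      · exact ⟨i, j, toBr _ _ _ hi' hj' h⟩
      · exact key j i hj' hi' h.symm
      · exact key i j hi' hj' h
      · exact (h.2 (by rw [hi', hj'])).elim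
    have key : ∀ i j, i + m + 1 < p + ℓ → j + m + 1 = p + ℓ → ¬ Imbalance X m i j := by
      rintro i j hi hj ⟨h1, h2, h3, h4⟩
      rcases le_or_gt ℓ m with hm | hm
      · have hag : Agree X ℓ (i + 1 + (m - ℓ)) p := fun k hk => by
          have := h4 (m - ℓ + k) (by omega)
          rwa [← add_assoc, show j + 1 + (m - ℓ + k) = p + k by omega] at this
        rcases hv _ (by omega) hag with h | h <;> omega
      · have hc : X i = Z (p + ℓ) := by
          rw [hj] at h3
          exact AB.eq_of_ne_of_ne h1 (by rw [← h3]; exact Ne.symm hy)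
        have hag : Agree Z (m + 1) (i + 1) (j + 1) := by
          refine agree_succ_iff_last.mpr ⟨fun k hk => ?_, ?_⟩
          · rw [← hX _ (by omega), ← hX _ (by omega)]
            exact h4 k hk
          · rw [show i + 1 + m = i + m + 1 by omega, show j + 1 + m = p + ℓ by omega,
              ← hX _ hi, h2, hc]
        have hmp : m + 2 < p := by
          by_contra hcon
          refine h1 ?_
          rw [hX i (by omega), hX j (by omega)]
          exact eq_of_agree_succ hp hZ (by omega) hag
        obtain ⟨l, hl, hlag⟩ := hrep (m + 1 + 1) (by omega)
        rw [show p + ℓ + 1 - (m + 1 + 1) = j by omega] at hlag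
        obtain ⟨h5, h6⟩ := agree_succ_iff_last.mp hlag
        obtain ⟨h7, h8⟩ := agree_succ_iff_head.mp h5
        refine hbal m i l (toIm i l hi (by omega) ⟨by rwa [h7], h2, ?_, h4.trans h8.symm⟩)
        rw [h7, ← h3]
        exact h6
    rcases hi.lt_or_eq with hi' | hi' <;> rcases hj.lt_or_eq with hj' | hj'
    · exact hbal m i j (toIm i j hi' hj' him)
    · exact key i j hi' hj' him
    · exact key j i hj' hi' him.symm
    · have : i = j := by omega
      exact him.1 (by rw [this])

end Periodic

/-! ### Translation from words to positions -/

/-- The letter of `w` at position `i`. -/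
def letter (w : Word) (i : ℕ) : AB := w.getD i a

theorem letter_append_left {u w : Word} {i : ℕ} (hi : i < u.length) :
    letter (u ++ w) i = letter u i := List.getD_append _ _ _ _ hi

theorem letter_append_right (u w : Word) (i : ℕ) :
    letter (u ++ w) (u.length + i) = letter w i := by
  rw [letter, List.getD_append_right _ _ _ _ (by omega)]
  simp [letter]

theorem occursAt_iff {u w : Word} {i : ℕ} :
    OccursAt u w i ↔ i + u.length ≤ w.length ∧ ∀ k < u.length, letter w (i + k) = letter u k := by
  refine and_congr_right fun h => ⟨fun h' k hk => ?_, fun h' => List.ext_getElem ?_ ?_⟩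
  · conv_rhs => rw [← h']
    simp [letter, List.getD_eq_getElem?_getD, hk]
  · simp only [List.length_take, List.length_drop]
    omega
  · intro k h1 hk
    have := h' k hk
    rw [letter, letter, List.getD_eq_getElem _ _ (by omega), List.getD_eq_getElem _ _ hk] at this
    simpa using this

theorem exists_letter_of_isInfix {u w : Word} (h : u <:+: w) :
    ∃ i, i + u.length ≤ w.length ∧ ∀ k < u.length, letter w (i + k) = letter u k := by
  obtain ⟨s, t, rfl⟩ := h
  refine ⟨s.length, by simp, fun k hk => ?_⟩
  rw [List.append_assoc, letter_append_right, letter_append_left hk]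

theorem letter_of_isSuffix {u w : Word} (h : u <:+ w) {k : ℕ} :
    letter w (w.length - u.length + k) = letter u k := by
  obtain ⟨s, rfl⟩ := h
  rw [← letter_append_right s u k]
  simp

theorem letter_of_isPrefix {u w : Word} (h : u <+: w) {k : ℕ} (hk : k < u.length) :
    letter w k = letter u k := by
  obtain ⟨s, rfl⟩ := h
  exact letter_append_left hk

theorem occursAt_iff_agree_of_isSuffix {u w : Word} (h : u <:+ w) {i : ℕ} :
    OccursAt u w i ↔
      i + u.length ≤ w.length ∧ Agree (letter w) u.length i (w.length - u.length) := by
  simp only [occursAt_iff, Agree, letter_of_isSuffix h]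

theorem occursOnce_iff_of_isSuffix {u w : Word} (h : u <:+ w) :
    OccursOnce u w ↔ ∀ i, i + u.length ≤ w.length →
      Agree (letter w) u.length i (w.length - u.length) → i + u.length = w.length := by
  have hle := h.length_le
  have hocc : OccursAt u w (w.length - u.length) :=
    (occursAt_iff_agree_of_isSuffix h).mpr ⟨by omega, fun _ _ => rfl⟩
  constructor
  · intro hu i hi hag
    have := hu.unique ((occursAt_iff_agree_of_isSuffix h).mpr ⟨hi, hag⟩) hocc
    omega
  · refine fun hu => ⟨_, hocc, fun i hi => ?_⟩
    obtain ⟨h1, h2⟩ := (occursAt_iff_agree_of_isSuffix h).mp hi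
    have := hu i h1 h2
    omega

theorem Kp_le {w : Word} {n : ℕ} (hn : n ≤ w.length)
    (h : ∀ i, i + n ≤ w.length → Agree (letter w) n i (w.length - n) → i + n = w.length) :
    Kp w ≤ n := by
  have hlen : (w.drop (w.length - n)).length = n := by
    rw [List.length_drop]
    omega
  refine Nat.sInf_le ⟨w.drop (w.length - n), List.drop_suffix _ _, hlen, ?_⟩
  rw [occursOnce_iff_of_isSuffix (List.drop_suffix _ _), hlen]
  exact h

theorem Kp_le_length (w : Word) : Kp w ≤ w.length := Kp_le le_rfl fun i hi _ => by omega

theorem exists_agree_of_lt_Kp {w : Word} {n : ℕ} (hn : n < Kp w) :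
    ∃ i, i + n < w.length ∧ Agree (letter w) n i (w.length - n) := by
  by_contra! hcon
  refine absurd (Kp_le (hn.le.trans (Kp_le_length w)) fun i hi hag => ?_) (not_le.mpr hn)
  by_contra hne
  exact hcon i (by omega) hag

theorem exists_branches_of_lt_Rp {w : Word} {n : ℕ} (hn : n < Rp w) :
    ∃ i j, i + n + 1 ≤ w.length ∧ j + n + 1 ≤ w.length ∧ Branches (letter w) n i j := by
  have h := Nat.notMem_of_lt_sInf hn
  simp only [Set.mem_ofPred_eq, not_forall, not_not] at h
  obtain ⟨u, rfl, ha, hb⟩ := h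
  obtain ⟨i, hi, hia⟩ := exists_letter_of_isInfix ha
  obtain ⟨j, hj, hjb⟩ := exists_letter_of_isInfix hb
  simp only [List.length_append, List.length_singleton] at hi hj hia hjb
  refine ⟨i, j, by omega, by omega, fun k hk => ?_, ?_⟩
  · rw [hia k (by omega), hjb k (by omega), letter_append_left hk, letter_append_left hk]
  · rw [hia _ (by omega), hjb _ (by omega), ← add_zero u.length, letter_append_right,
      letter_append_right]
    simp [letter]

theorem exists_imbalance_of_not_isSturmian {w : Word} (h : ¬ IsSturmian w) :
    ∃ m i j, i + m + 2 ≤ w.length ∧ j + m + 2 ≤ w.length ∧ Imbalance (letter w) m i j := by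
  obtain ⟨u, ha, hb⟩ := not_not.mp h
  have key : ∀ c : AB, ([c] ++ u ++ [c]) <:+: w → ∃ i, i + u.length + 2 ≤ w.length ∧
      letter w i = c ∧ letter w (i + u.length + 1) = c ∧
      ∀ k < u.length, letter w (i + 1 + k) = letter u k := by
    intro c hc
    obtain ⟨i, hi, hic⟩ := exists_letter_of_isInfix hc
    simp only [List.length_append, List.length_singleton] at hi hic
    refine ⟨i, by omega, ?_, ?_, fun k hk => ?_⟩
    · simpa [letter] using hic 0 (by omega)
    · have h1 := hic (1 + u.length) (by omega)
      have h2 := letter_append_right ([c] ++ u) [c] 0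
      rw [List.length_append, List.length_singleton, add_zero] at h2
      rw [h2] at h1
      rw [show i + u.length + 1 = i + (1 + u.length) by omega, h1]
      simp [letter]
    · rw [add_assoc, hic (1 + k) (by omega), List.append_assoc]
      exact (letter_append_right [c] (u ++ [c]) k).trans (letter_append_left hk)
  obtain ⟨i, hi, hi0, hi1, hiu⟩ := key a ha
  obtain ⟨j, hj, hj0, hj1, hju⟩ := key b hb
  refine ⟨u.length, i, j, hi, hj, ?_, ?_, ?_, fun k hk => ?_⟩
  · simp [hi0, hj0]
  · rw [hi0, hi1]
  · rw [hj0, hj1]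
  · rw [hiu k hk, hju k hk]

/-- if `wy` is trapezoidal but not Sturmian, then `w` is open. -/
theorem open_of_extension_trapezoidal_non_sturmian (w : Word) (y : AB)
    (htrap : IsTrapezoidal (w ++ [y])) (hnst : ¬ IsSturmian (w ++ [y])) :
    IsOpenWord w := by
  obtain ⟨m, i, j, hi, hj, him⟩ := exists_imbalance_of_not_isSturmian hnst
  have hlen : (w ++ [y]).length = w.length + 1 := by simp
  have hw : w ≠ [] := by
    rintro rfl
    simp at hi
  refine ⟨hw, ?_⟩
  rintro ⟨-, v, hpre, hlt, hsuf, hocc⟩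
  obtain ⟨p, hp⟩ : ∃ p, w.length = p + v.length := ⟨w.length - v.length, by omega⟩
  have hwv : w.length - v.length = p := by omega
  have hp0 : 0 < p := by omega
  have hX : ∀ i < p + v.length, letter (w ++ [y]) i = letter w i := fun i hi =>
    letter_append_left (by omega)
  have hper : ∀ i < p + v.length, letter w i = letter w (i % p) := by
    intro i
    induction i using Nat.strong_induction_on with
    | _ i ih =>
    intro hi
    rcases lt_or_ge i p with h | h
    · rw [Nat.mod_eq_of_lt h]
    · obtain ⟨k, rfl⟩ := Nat.exists_eq_add_of_le h
      have h1 := letter_of_isSuffix hsuf (k := k)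
      rw [hwv] at h1
      rw [h1, ← letter_of_isPrefix hpre (by omega), ih k (by omega) (by omega),
        Nat.add_mod_left]
  rw [IsTrapezoidal, hlen, hp] at htrap
  have hK : ∀ n ≤ p + v.length + 1, (∀ i, i + n ≤ p + v.length + 1 →
      Agree (letter (w ++ [y])) n i (p + v.length + 1 - n) → i + n = p + v.length + 1) →
      Kp (w ++ [y]) ≤ n := by
    intro n hn h
    refine Kp_le ?_ ?_ <;> rw [hlen, hp]
    exacts [hn, h]
  refine not_imbalance_of_trapezoidal (Z := fun i => letter w (i % p)) hp0
    (fun i => by simp) (fun i hi => (hX i hi).trans (hper i hi)) ?_ htrap hK ?_ ?_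
    (m := m) (i := i) (j := j) (by omega) (by omega) him
  · intro i hi hag
    have h1 : OccursAt v w i := by
      refine (occursAt_iff_agree_of_isSuffix hsuf).mpr ⟨by omega, fun k hk => ?_⟩
      rw [hwv, ← hX _ (by omega), ← hX _ (by omega)]
      exact hag k hk
    rcases hocc i h1 with h | h <;> omega
  · intro n hn
    obtain ⟨i, hi, hag⟩ := exists_agree_of_lt_Kp hn
    rw [hlen, hp] at hi hag
    exact ⟨i, hi, hag⟩
  · intro n hn
    obtain ⟨i, j, hi, hj, h⟩ := exists_branches_of_lt_Rp hn
    exact ⟨i, j, by omega, by omega, h⟩
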